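/- Let X be a finite Abelian group containing no elements of order 2, and let α be an automorphism of X such that I + α is an automorphism of X. Let ξ₁, ξ₂ be independent X-valued random variables with distributions μ₁, μ₂. If the conditional distribution of the linear form L₂ = ξ₁ + αξ₂ given L₁ = ξ₁ + ξ₂ is symmetric, then each μ_j is an idempotent distribution, i.e., μ_j ∈ I(X) for j = 1, 2. -/

import Mathlib

open MeasureTheory ProbabilityTheory

/-- A distribution on a finite Abelian group `X` is idempotent if it is a shift `m_K * E_x`
of the Haar (uniform) distribution `m_K` of a subgroup `K` of `X` (characterized as the
`K`-invariant probability distribution concentrated on `K`). -/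
def IsIdempotentDist {X : Type*} [AddCommGroup X] [MeasurableSpace X] (μ : Measure X) : Prop :=
  ∃ (K : AddSubgroup X) (m : Measure X) (x : X),
    IsProbabilityMeasure m ∧ m (K : Set X) = 1 ∧
    (∀ k ∈ K, Measure.map (fun z => k + z) m = m) ∧
    μ = Measure.map (fun z => x + z) m

/-- A function bounded by its value `1` at `0`, invariant under translation by the points where it
equals `1` and not increased by an endomorphism `κ` of a finite group is `κ`-invariant. -/
lemma apply_endomorphism_eq_of_le {Y : Type*} [AddCommGroup Y] [Finite Y] (F : Y → ℝ)
    (hF0 : F 0 = 1) (hF1 : ∀ u, F u ≤ 1) (hFinv : ∀ n u, F n = 1 → F (u + n) = F u)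
    (κ : AddMonoid.End Y) (hκ : ∀ w, F (κ w) ≤ F w) (w : Y) : F (κ w) = F w := by
  have hpow : ∀ (n : ℕ) w, F ((κ ^ n) w) ≤ F w := by
    intro n
    induction n with
    | zero => intro w; simp
    | succ k ih => intro w; rw [pow_succ]; exact (ih (κ w)).trans (hκ w)
  have : Finite (AddMonoid.End Y) := Finite.of_injective (fun f : AddMonoid.End Y => (f : Y → Y))
    DFunLike.coe_injective
  obtain ⟨m, n, hmn, h⟩ : ∃ m n : ℕ, m < n ∧ κ ^ m = κ ^ n := by
    obtain ⟨m, n, hne, h⟩ := Finite.exists_ne_map_eq_of_infinite (fun n : ℕ => κ ^ n)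
    rcases lt_or_gt_of_ne hne with h' | h'
    · exact ⟨m, n, h', h⟩
    · exact ⟨n, m, h', h.symm⟩
  obtain ⟨d, rfl⟩ : ∃ d, n = m + (d + 1) := ⟨n - m - 1, by omega⟩
  have hker : F (w - (κ ^ (d + 1)) w) = 1 := by
    refine le_antisymm (hF1 _) ?_
    have h0 : (κ ^ m) (w - (κ ^ (d + 1)) w) = 0 := by
      rw [map_sub, sub_eq_zero]
      conv_lhs => rw [h, pow_add]
      rfl
    calc (1 : ℝ) = F ((κ ^ m) (w - (κ ^ (d + 1)) w)) := by rw [h0, hF0]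
      _ ≤ _ := hpow m _
  have hw : F w = F ((κ ^ (d + 1)) w) := by
    rw [← hFinv _ ((κ ^ (d + 1)) w) hker, add_sub_cancel]
  refine le_antisymm (hκ w) ?_
  rw [hw, pow_succ]
  exact hpow d (κ w)

/-- If an injective self-map of a finite type sends the support of `F` into
`{F = 1}`, then `F` only takes the values `0` and `1`. -/
lemma eq_zero_or_one_of_injective {Y : Type*} [Finite Y] (F : Y → ℝ) (T : Y → Y)
    (hT : Function.Injective T) (h : ∀ u, F u ≠ 0 → F (T u) = 1) (u : Y) : F u = 0 ∨ F u = 1 := by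
  by_cases hu : F u = 0
  · exact Or.inl hu
  · right
    let S := {u // F u ≠ 0}
    let T' : S → S := fun u => ⟨T u, by rw [h u u.2]; exact one_ne_zero⟩
    have hT' : Function.Injective T' := fun a b hab =>
      Subtype.ext (hT (congrArg Subtype.val hab))
    obtain ⟨v, hv⟩ := Finite.surjective_of_injective hT' ⟨u, hu⟩
    have hvu : T v = u := congrArg Subtype.val hv
    rw [← hvu]
    exact h v v.2

/-- Solutions of the modulus of the Heyde functional equation on a finite group take only the
values `0` and `1`. -/
lemma eq_zero_or_one_of_heyde_equation {Y : Type*} [AddCommGroup Y] [Finite Y] (F G : Y → ℝ)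
    (hF0 : F 0 = 1) (hF1 : ∀ u, F u ≤ 1) (hFpos : ∀ u, 0 ≤ F u) (hFneg : ∀ u, F (-u) = F u)
    (hFinv : ∀ n u, F n = 1 → F (u + n) = F u)
    (hG0 : G 0 = 1) (hG1 : ∀ u, G u ≤ 1) (hGpos : ∀ u, 0 ≤ G u)
    (hGinv : ∀ n u, G n = 1 → G (u + n) = G u)
    (ε : AddMonoid.End Y) (hε : Function.Injective ε) (h1ε : Function.Injective (1 + ε : AddMonoid.End _))
    (h2 : ∀ u : Y, u + u = 0 → u = 0)
    (heq : ∀ u v, F (u + v) * G (u + ε v) = F (u - v) * G (u - ε v)) :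
    (∀ u, F u = 0 ∨ F u = 1) ∧ (∀ u, G u = 0 ∨ G u = 1) := by
  have hbij : Function.Bijective (1 + ε : AddMonoid.End Y) := Finite.injective_iff_bijective.mp h1ε
  let e : Y ≃+ Y := AddEquiv.ofBijective (1 + ε : AddMonoid.End Y) hbij
  let S : AddMonoid.End Y := e.symm.toAddMonoidHom
  have hS : ∀ w, S w + ε (S w) = w := fun w => e.apply_symm_apply w
  have hSinj : Function.Injective S := e.symm.injective
  have hdbl : Function.Injective fun u : Y => u + u := by
    intro a b hab
    have : (a - b) + (a - b) = 0 := by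
      have hab' : a + a = b + b := hab
      rw [sub_add_sub_comm, hab', sub_self]
    exact sub_eq_zero.mp (h2 _ this)
  let κ : AddMonoid.End Y := (1 - ε) * S
  have hκ : ∀ w, κ w = S w - ε (S w) := fun w => rfl
  have hGκ : ∀ w, G (κ w) = F (S w + S w) * G w := by
    intro w
    have := heq (S w) (S w)
    rw [hS, sub_self, hF0, one_mul] at this
    rw [hκ, this]
  have hFκ : ∀ w, F (κ w) = F w * G (ε (S w) + ε (S w)) := by
    intro w
    have := heq (ε (S w)) (S w)
    rw [sub_self, hG0, mul_one, add_comm (ε (S w)) (S w), hS] at this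
    rw [hκ, this, ← hFneg, neg_sub]
  have hGκ' := apply_endomorphism_eq_of_le G hG0 hG1 hGinv κ
    (fun w => by rw [hGκ]; exact mul_le_of_le_one_left (hGpos w) (hF1 _))
  have hFκ' := apply_endomorphism_eq_of_le F hF0 hF1 hFinv κ
    (fun w => by rw [hFκ]; exact mul_le_of_le_one_right (hFpos w) (hG1 _))
  have hGF : ∀ w, G w ≠ 0 → F (S w + S w) = 1 := fun w hw =>
    mul_right_cancel₀ hw (by rw [← hGκ, hGκ', one_mul])
  have hFG : ∀ w, F w ≠ 0 → G (ε (S w) + ε (S w)) = 1 := fun w hw =>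
    mul_left_cancel₀ hw (by rw [← hFκ, hFκ', mul_one])
  have hA : Function.Injective fun w => S w + S w := hdbl.comp hSinj
  have hB : Function.Injective fun w => ε (S w) + ε (S w) := hdbl.comp (hε.comp hSinj)
  refine ⟨eq_zero_or_one_of_injective F _ (hA.comp hB) fun u hu => ?_,
    eq_zero_or_one_of_injective G _ (hB.comp hA) fun u hu => ?_⟩
  · exact hGF _ (by rw [hFG u hu]; exact one_ne_zero)
  · exact hFG _ (by rw [hGF u hu]; exact one_ne_zero)

section FourierTransform

variable {X : Type*} [AddCommGroup X] [MeasurableSpace X]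

/-- The characteristic function of a distribution on a finite Abelian group. -/
noncomputable def charTransform (μ : Measure X) (ψ : AddChar X ℂ) : ℂ := ∫ x, ψ x ∂μ

lemma charTransform_zero (μ : Measure X) [IsProbabilityMeasure μ] : charTransform μ 0 = 1 := by
  simp [charTransform]

variable [Fintype X]

lemma norm_charTransform_le_one (μ : Measure X) [IsProbabilityMeasure μ] (ψ : AddChar X ℂ) :
    ‖charTransform μ ψ‖ ≤ 1 := by
  refine (norm_integral_le_integral_norm _).trans ?_
  simp

lemma norm_charTransform_neg (μ : Measure X) (ψ : AddChar X ℂ) :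
    ‖charTransform μ (-ψ)‖ = ‖charTransform μ ψ‖ := by
  rw [← RCLike.norm_conj (charTransform μ ψ), charTransform, charTransform, ← integral_conj]
  congr 2
  ext x
  rw [AddChar.neg_apply, AddChar.map_neg_eq_conj]

variable [MeasurableSingletonClass X]

lemma charTransform_eq_sum (μ : Measure X) [IsFiniteMeasure μ] (ψ : AddChar X ℂ) :
    charTransform μ ψ = ∑ x, (μ.real {x} : ℂ) * ψ x := by
  simp [charTransform, integral_fintype (Integrable.of_finite)]

/-- A character whose mean has modulus one equals that mean on every atom. -/
lemma apply_eq_charTransform (μ : Measure X) [IsProbabilityMeasure μ] {ψ : AddChar X ℂ}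
    (h : ‖charTransform μ ψ‖ = 1) {x : X} (hx : μ.real {x} ≠ 0) : ψ x = charTransform μ ψ := by
  set c := charTransform μ ψ with hc
  have hcc : starRingEnd ℂ c * c = 1 := by
    rw [Complex.conj_mul', h]; norm_num
  have hnorm : ∀ y, ‖starRingEnd ℂ c * ψ y‖ = 1 := by
    intro y; simp [h]
  have hp : ∑ y, μ.real {y} = 1 := by
    simp
  have hre : ∑ y, μ.real {y} * (starRingEnd ℂ c * ψ y).re = 1 := by
    have : ∑ y, (μ.real {y} : ℂ) * (starRingEnd ℂ c * ψ y) = 1 := by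
      rw [← hcc]
      conv_rhs => rw [hc, charTransform_eq_sum, Finset.mul_sum]
      rw [charTransform_eq_sum] at hc
      refine Finset.sum_congr rfl fun y _ => ?_
      rw [← hc]; ring
    simpa only [Complex.re_sum, Complex.re_ofReal_mul, Complex.one_re] using congrArg Complex.re this
  have hsum : ∑ y, μ.real {y} * (1 - (starRingEnd ℂ c * ψ y).re) = 0 := by
    simp only [mul_sub, mul_one, Finset.sum_sub_distrib, hp, hre, sub_self]
  have hle : ∀ y, (starRingEnd ℂ c * ψ y).re ≤ 1 := fun y =>
    (Complex.re_le_norm _).trans (hnorm y).le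
  rw [Finset.sum_eq_zero_iff_of_nonneg fun y _ =>
    mul_nonneg measureReal_nonneg (sub_nonneg.mpr (hle y))] at hsum
  have hx1 : (starRingEnd ℂ c * ψ x).re = 1 := by
    have := (mul_eq_zero.mp (hsum x (Finset.mem_univ x))).resolve_left hx
    linarith
  have hone : starRingEnd ℂ c * ψ x = 1 := by
    have hsq := Complex.sq_norm_sub_sq_re (starRingEnd ℂ c * ψ x)
    rw [hnorm, hx1, sub_self] at hsq
    exact Complex.ext hx1 (pow_eq_zero_iff two_ne_zero |>.mp hsq.symm)
  have hc0 : starRingEnd ℂ c ≠ 0 := left_ne_zero_of_mul (hcc ▸ one_ne_zero)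
  exact mul_left_cancel₀ hc0 (hone.trans hcc.symm)

lemma norm_charTransform_add (μ : Measure X) [IsProbabilityMeasure μ] (ψ φ : AddChar X ℂ)
    (h : ‖charTransform μ ψ‖ = 1) : ‖charTransform μ (φ + ψ)‖ = ‖charTransform μ φ‖ := by
  have : charTransform μ (φ + ψ) = charTransform μ φ * charTransform μ ψ := by
    rw [charTransform_eq_sum, charTransform_eq_sum μ φ, Finset.sum_mul]
    refine Finset.sum_congr rfl fun x _ => ?_
    by_cases hx : μ.real {x} = 0
    · simp [hx]
    · rw [AddChar.add_apply, apply_eq_charTransform μ h hx, mul_assoc]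
  rw [this, norm_mul, h, mul_one]

/-- Fourier inversion on a finite Abelian group. -/
lemma card_mul_measureReal_singleton (μ : Measure X) [IsFiniteMeasure μ] (y : X) :
    (Fintype.card X : ℂ) * μ.real {y} = ∑ ψ : AddChar X ℂ, charTransform μ ψ * ψ (-y) := by
  classical
  simp_rw [charTransform_eq_sum, Finset.sum_mul]
  rw [Finset.sum_comm]
  simp_rw [mul_assoc, ← AddChar.map_add_eq_mul, ← Finset.mul_sum, AddChar.sum_apply_eq_ite,
    ← sub_eq_add_neg, sub_eq_zero]
  simp [mul_comm]

/-- A distribution whose characteristic function has modulus `0` or `1` everywhere is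
idempotent. -/
lemma isIdempotentDist_of_norm_charTransform (μ : Measure X) [IsProbabilityMeasure μ]
    (h : ∀ ψ, ‖charTransform μ ψ‖ = 0 ∨ ‖charTransform μ ψ‖ = 1) : IsIdempotentDist μ := by
  obtain ⟨a, ha⟩ : ∃ a, μ.real {a} ≠ 0 := by
    by_contra! hall
    have hp : ∑ y, μ.real {y} = 1 := by simp
    simp [hall] at hp
  let K : AddSubgroup X :=
    { carrier := {k | ∀ ψ : AddChar X ℂ, ‖charTransform μ ψ‖ = 1 → ψ k = 1}
      zero_mem' := fun ψ _ => ψ.map_zero_eq_one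
      add_mem' := fun {x y} hx hy ψ hψ => by
        rw [AddChar.map_add_eq_mul, hx ψ hψ, hy ψ hψ, one_mul]
      neg_mem' := fun {x} hx ψ hψ => by
        rw [AddChar.map_neg_eq_inv, hx ψ hψ, inv_one] }
  have hmeas : ∀ f : X → X, Measurable f := fun f => measurable_of_finite f
  have hprob : IsProbabilityMeasure (μ.map fun z => -a + z) :=
    Measure.isProbabilityMeasure_map (hmeas _).aemeasurable
  have hinv : ∀ k ∈ K, ∀ y, μ.real {y + k} = μ.real {y} := by
    intro k hk y
    have hcard : (Fintype.card X : ℂ) ≠ 0 := Nat.cast_ne_zero.mpr Fintype.card_ne_zero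
    have : (μ.real {y + k} : ℂ) = μ.real {y} := by
      refine mul_left_cancel₀ hcard ?_
      rw [card_mul_measureReal_singleton, card_mul_measureReal_singleton]
      refine Finset.sum_congr rfl fun ψ _ => ?_
      rcases h ψ with h0 | h1
      · simp [norm_eq_zero.mp h0]
      · rw [neg_add, AddChar.map_add_eq_mul, K.neg_mem hk ψ h1, mul_one]
    exact_mod_cast this
  have hshift : ∀ k ∈ K, μ.map (fun z => k + z) = μ := by
    intro k hk
    refine Measure.ext_of_singleton fun y => ?_
    rw [Measure.map_apply (hmeas _) (measurableSet_singleton y)]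
    have : (fun z => k + z) ⁻¹' {y} = {y + -k} := by
      ext z
      simp only [Set.mem_preimage, Set.mem_singleton_iff]
      rw [← sub_eq_add_neg, eq_sub_iff_add_eq, add_comm]
    rw [this, ← measureReal_eq_measureReal_iff]
    exact hinv _ (K.neg_mem hk) y
  refine ⟨K, μ.map fun z => -a + z, a, hprob, ?_, fun k hk => ?_, ?_⟩
  · rw [Measure.map_apply (hmeas _) (Set.toFinite _).measurableSet,
      ← prob_compl_eq_zero_iff (Set.toFinite _).measurableSet, ← Set.biUnion_of_singleton (_ᶜ),
      measure_biUnion_null_iff (Set.to_countable _)]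
    intro x hx
    by_contra hne
    refine hx fun ψ hψ => ?_
    have hψa := apply_eq_charTransform μ hψ ha
    have hψx := apply_eq_charTransform μ hψ (x := x) (by simpa [measureReal_eq_zero_iff] using hne)
    rw [AddChar.map_add_eq_mul, hψx, ← hψa, ← AddChar.map_add_eq_mul, neg_add_cancel,
      AddChar.map_zero_eq_one]
  · conv_rhs => rw [← hshift k hk]
    rw [Measure.map_map (hmeas _) (hmeas _), Measure.map_map (hmeas _) (hmeas _)]
    congr 1
    ext z
    simp only [Function.comp_apply]
    abel
  · rw [Measure.map_map (hmeas _) (hmeas _)]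
    simp [Function.comp_def]

end FourierTransform

/-- Theorem B: let `X` be a finite Abelian group containing no elements of order 2, and `α`
an automorphism of `X` with `I + α` an automorphism. If the conditional distribution of
`L₂ = ξ₁ + α ξ₂` given `L₁ = ξ₁ + ξ₂` is symmetric, then `μⱼ ∈ I(X)`, `j = 1, 2`. -/
theorem heyde_theoremB {X : Type*} [AddCommGroup X] [Fintype X]
    [MeasurableSpace X] [MeasurableSingletonClass X]
    (h2 : ∀ x : X, x + x = 0 → x = 0)
    (α : X ≃+ X) (hIα : Function.Bijective fun x : X => x + α x)
    {Ω : Type*} [MeasurableSpace Ω] (P : Measure Ω) [IsProbabilityMeasure P]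
    (ξ₁ ξ₂ : Ω → X) (hm₁ : Measurable ξ₁) (hm₂ : Measurable ξ₂)
    (hindep : IndepFun ξ₁ ξ₂ P)
    (hsym : P.map (fun ω => (ξ₁ ω + ξ₂ ω, ξ₁ ω + α (ξ₂ ω))) =
      P.map (fun ω => (ξ₁ ω + ξ₂ ω, -(ξ₁ ω + α (ξ₂ ω))))) :
    IsIdempotentDist (P.map ξ₁) ∧ IsIdempotentDist (P.map ξ₂) := by
  have : IsProbabilityMeasure (P.map ξ₁) := Measure.isProbabilityMeasure_map hm₁.aemeasurable
  have : IsProbabilityMeasure (P.map ξ₂) := Measure.isProbabilityMeasure_map hm₂.aemeasurable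
  let ε : AddMonoid.End (AddChar X ℂ) :=
    { toFun := fun ψ => ψ.compAddMonoidHom α.toAddMonoidHom
      map_zero' := rfl
      map_add' := fun _ _ => rfl }
  have hεapp : ∀ ψ x, ε ψ x = ψ (α x) := fun _ _ => rfl
  have hprod : ∀ φ ψ : AddChar X ℂ,
      ∫ ω, φ (ξ₁ ω) * ψ (ξ₂ ω) ∂P = charTransform (P.map ξ₁) φ * charTransform (P.map ξ₂) ψ := by
    intro φ ψ
    have hφ : Measurable φ := measurable_of_finite _
    have hψ : Measurable ψ := measurable_of_finite _
    rw [charTransform, charTransform,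
      integral_map hm₁.aemeasurable hφ.aestronglyMeasurable,
      integral_map hm₂.aemeasurable hψ.aestronglyMeasurable]
    exact (hindep.comp hφ hψ).integral_fun_mul_eq_mul_integral
      (hφ.comp hm₁).aestronglyMeasurable (hψ.comp hm₂).aestronglyMeasurable
  have heq : ∀ u v, charTransform (P.map ξ₁) (u + v) * charTransform (P.map ξ₂) (u + ε v) =
      charTransform (P.map ξ₁) (u - v) * charTransform (P.map ξ₂) (u - ε v) := by
    intro u v
    have hL₁ : Measurable fun ω => ξ₁ ω + ξ₂ ω :=
      (measurable_of_finite fun p : X × X => p.1 + p.2).comp (hm₁.prodMk hm₂)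
    have hL₂ : Measurable fun ω => ξ₁ ω + α (ξ₂ ω) :=
      (measurable_of_finite fun p : X × X => p.1 + α p.2).comp (hm₁.prodMk hm₂)
    have hL₂' : Measurable fun ω => -(ξ₁ ω + α (ξ₂ ω)) :=
      (measurable_of_finite fun x : X => -x).comp hL₂
    have hf : Measurable fun p : X × X => u p.1 * v p.2 := measurable_of_finite _
    have key := congrArg (fun m => ∫ p, u p.1 * v p.2 ∂m) hsym
    rw [integral_map (hL₁.prodMk hL₂).aemeasurable hf.aestronglyMeasurable,
      integral_map (hL₁.prodMk hL₂').aemeasurable hf.aestronglyMeasurable] at key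
    rw [← hprod, ← hprod]
    convert key using 2
    · ext ω
      simp only [AddChar.add_apply, AddChar.map_add_eq_mul, hεapp]
      ring
    · ext ω
      simp only [sub_eq_add_neg, neg_add, AddChar.add_apply, AddChar.neg_apply,
        AddChar.map_add_eq_mul, map_neg, hεapp]
      ring
  have hε : Function.Injective ε := by
    intro ψ φ h
    ext x
    simpa [hεapp] using DFunLike.congr_fun h (α.symm x)
  have h1ε : Function.Injective (1 + ε : AddMonoid.End _) := by
    rw [injective_iff_map_eq_zero]
    intro ψ h
    ext x
    obtain ⟨y, rfl⟩ := hIα.2 x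
    have := DFunLike.congr_fun h y
    rw [AddChar.map_add_eq_mul]
    exact this
  have hdbl : ∀ ψ : AddChar X ℂ, ψ + ψ = 0 → ψ = 0 := by
    intro ψ h
    have hinj : Function.Injective fun x : X => x + x := by
      intro a b hab
      have hab' : a + a = b + b := hab
      exact sub_eq_zero.mp (h2 _ (by rw [sub_add_sub_comm, hab', sub_self]))
    ext x
    obtain ⟨y, rfl⟩ := Finite.surjective_of_injective hinj x
    rw [AddChar.map_add_eq_mul]
    exact DFunLike.congr_fun h y
  have main := eq_zero_or_one_of_heyde_equation
    (fun ψ => ‖charTransform (P.map ξ₁) ψ‖) (fun ψ => ‖charTransform (P.map ξ₂) ψ‖)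
    (by simp [charTransform_zero]) (norm_charTransform_le_one _) (fun _ => norm_nonneg _)
    (norm_charTransform_neg _) (norm_charTransform_add _)
    (by simp [charTransform_zero]) (norm_charTransform_le_one _) (fun _ => norm_nonneg _)
    (norm_charTransform_add _) ε hε h1ε hdbl
    (fun u v => by simpa only [norm_mul] using congrArg norm (heq u v))
  exact ⟨isIdempotentDist_of_norm_charTransform _ main.1,
    isIdempotentDist_of_norm_charTransform _ main.2⟩
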